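/- There is a universal constant C > 0 such that the following holds. Let n ≥ 2, let δ_1,…,δ_n > −1 be real numbers, and set B = diag(1+δ_1,…,1+δ_n) and ε = max_i |1 − 1/(1+δ_i)|, and assume ε ≤ 1. For each vector v = e_i + e_j (1 ≤ i < j ≤ n) let v' = ((1+δ_1)^{-1}v_1,…,(1+δ_n)^{-1}v_n), and let 𝒱' = {v' : v = e_i + e_j, 1 ≤ i < j ≤ n} (so Bv' ∈ ℤ^n for each v' ∈ 𝒱'). Let {a_{v'}}_{v'∈𝒱'} be a uniform random point of the sphere of radius √2 in ℝ^{𝒱'}, independent of X, and let f(x) = Re(Σ_{v'∈𝒱'} a_{v'} e^{2πi⟨Bv',x⟩}). Then 𝔼_a[ d_TV(f(X), Z) ] ≤ C · max(1/√n, ε). -/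

import Mathlib

open MeasureTheory ProbabilityTheory Real Finset Matrix

noncomputable section

/-- total variation distance between two (Borel) measures on ℝ -/
def dTV (μ ν : MeasureTheory.Measure ℝ) : ℝ :=
  ⨆ s : {s : Set ℝ // MeasurableSet s}, |(μ s.1).toReal - (ν s.1).toReal|

/-- uniform probability measure on the unit sphere of a Euclidean space -/
def sphereUniform (ι : Type*) [Fintype ι] :
    MeasureTheory.Measure (Metric.sphere (0 : EuclideanSpace ℝ ι) 1) :=
  ((volume : MeasureTheory.Measure (EuclideanSpace ℝ ι)).toSphere Set.univ)⁻¹ •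
    (volume : MeasureTheory.Measure (EuclideanSpace ℝ ι)).toSphere

/-- the uniform probability measure on the flat torus `ℝ^n/ℤ^n`, modelled by Lebesgue
measure on the fundamental domain `[0,1)^n`. -/
def torusMeasure (n : ℕ) : MeasureTheory.Measure (Fin n → ℝ) :=
  volume.restrict (Set.univ.pi fun _ => Set.Ico (0 : ℝ) 1)

/-- the uniform probability distribution of the coefficients: a uniform random point of
the sphere of radius `√2` in `ℝ^𝒱`. -/
def coeffMeasure {n : ℕ} (𝒱 : Finset (Fin n → ℝ)) : MeasureTheory.Measure (↥𝒱 → ℝ) :=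
  MeasureTheory.Measure.map
    (fun c : Metric.sphere (0 : EuclideanSpace ℝ ↥𝒱) 1 =>
      fun v => Real.sqrt 2 * (c : EuclideanSpace ℝ ↥𝒱) v)
    (sphereUniform ↥𝒱)

/-- `f(x) = Re ∑_{v ∈ 𝒱} a_v e^{2πi⟨Bv,x⟩}` -/
def torusFun {n : ℕ} (B : Matrix (Fin n) (Fin n) ℝ) (𝒱 : Finset (Fin n → ℝ))
    (a : ↥𝒱 → ℝ) (x : Fin n → ℝ) : ℝ :=
  (∑ v : ↥𝒱, (a v : ℂ) *
    Complex.exp (2 * π * Complex.I * ((B.mulVec v ⬝ᵥ x : ℝ) : ℂ))).re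

/-- `∇_B f(x) = −Im(∑_{v∈𝒱} 2π a_v e^{2πi⟨Bv,x⟩} v)` -/
def gradB {n : ℕ} (B : Matrix (Fin n) (Fin n) ℝ) (𝒱 : Finset (Fin n → ℝ))
    (a : ↥𝒱 → ℝ) (x : Fin n → ℝ) : Fin n → ℝ := fun k =>
  -(∑ v : ↥𝒱, 2 * π * (a v : ℂ) *
      Complex.exp (2 * π * Complex.I * ((B.mulVec v ⬝ᵥ x : ℝ) : ℂ)) *
      ((v : Fin n → ℝ) k : ℂ)).im

/-- `‖w‖_B² = ⟨Bw,w⟩` -/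
def normBsq {n : ℕ} (B : Matrix (Fin n) (Fin n) ℝ) (w : Fin n → ℝ) : ℝ :=
  B.mulVec w ⬝ᵥ w

end

section

/-- The integral over the torus of a directional derivative of a `C¹` periodic function vanishes. -/
theorem integral_torusMeasure_fderiv_eq_zero {n : ℕ} {G : (Fin n → ℝ) → ℝ}
    {G' : (Fin n → ℝ) → (Fin n → ℝ) →L[ℝ] ℝ} (hG : ∀ x, HasFDerivAt G (G' x) x)
    (hG' : Continuous G') (hper : ∀ k x, G (x + Pi.single k 1) = G x) (w : Fin n → ℝ) :
    ∫ x, G' x w ∂(torusMeasure n) = 0 := by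
  cases n with
  | zero =>
    obtain rfl : w = 0 := Subsingleton.elim w 0
    simp only [map_zero, integral_zero]
  | succ m =>
    have hcont : Continuous G := continuous_iff_continuousAt.2 fun x => (hG x).continuousAt
    have hsum : ∀ x, ∑ i, (w i • G' x) (Pi.single i 1) = G' x w := by
      intro x
      conv_rhs => rw [pi_eq_sum_univ' w, map_sum]
      refine Finset.sum_congr rfl fun i _ => ?_
      rw [map_smul]
      rfl
    have hint : IntegrableOn (fun x => ∑ i, (w i • G' x) (Pi.single i 1))
        (Set.Icc (0 : Fin (m + 1) → ℝ) 1) := by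
      simp_rw [hsum]
      exact (hG'.clm_apply continuous_const).continuousOn.integrableOn_compact isCompact_Icc
    have key := integral_divergence_of_hasFDerivAt_off_countable' (0 : Fin (m + 1) → ℝ) 1
      zero_le_one (fun i x => w i * G x) (fun i x => w i • G' x) ∅ Set.countable_empty
      (fun i => (continuous_const.mul hcont).continuousOn)
      (fun x _ i => (hG x).const_mul (w i)) hint
    simp_rw [hsum] at key
    have hm : torusMeasure (m + 1) = volume.restrict (Set.Icc (0 : Fin (m + 1) → ℝ) 1) := by
      rw [torusMeasure]
      exact Measure.restrict_congr_set
        (Measure.univ_pi_Ico_ae_eq_Icc (μ := fun _ => volume) (f := fun _ => (0 : ℝ))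
          (g := fun _ => 1))
    rw [hm, key]
    refine Finset.sum_eq_zero fun i _ => ?_
    rw [sub_eq_zero]
    refine integral_congr_ae (Filter.Eventually.of_forall fun y => ?_)
    have hy : i.insertNth (1 : ℝ) y = (i.insertNth (0 : ℝ) y : Fin (m + 1) → ℝ) + Pi.single i 1 := by
      ext j
      refine Fin.succAboveCases i ?_ (fun j => ?_) j <;> simp
    simp only [Pi.one_apply, Pi.zero_apply]
    rw [hy, hper]

instance isProbabilityMeasure_torusMeasure (n : ℕ) : IsProbabilityMeasure (torusMeasure n) := by
  constructor
  rw [torusMeasure, Measure.restrict_apply_univ, volume_pi_pi]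
  simp

theorem integrable_torusMeasure_of_continuous {n : ℕ} {G : (Fin n → ℝ) → ℝ} (hG : Continuous G) :
    Integrable G (torusMeasure n) := by
  have hK : IsCompact (Set.univ.pi fun _ : Fin n => Set.Icc (0 : ℝ) 1) :=
    isCompact_univ_pi fun _ => isCompact_Icc
  exact (hG.continuousOn.integrableOn_compact hK).mono_set
    (Set.pi_mono fun _ _ => Set.Ico_subset_Icc_self)

theorem integral_torusMeasure_cos_eq_zero {n : ℕ} {u : Fin n → ℝ} (hu : ∀ k, ∃ m : ℤ, u k = m)
    (hu0 : u ≠ 0) : ∫ x, Real.cos (2 * π * (u ⬝ᵥ x)) ∂(torusMeasure n) = 0 := by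
  obtain ⟨k, hk⟩ := Function.ne_iff.1 hu0
  let L : (Fin n → ℝ) →L[ℝ] ℝ := LinearMap.toContinuousLinearMap (dotProductBilin ℝ ℝ u)
  have hL : ∀ x, L x = u ⬝ᵥ x := fun x => rfl
  have hd : ∀ x, HasFDerivAt (fun x => Real.sin (2 * π * L x))
      (Real.cos (2 * π * L x) • ((2 * π) • L)) x := fun x => (L.hasFDerivAt.const_mul (2 * π)).sin
  have hLc : Continuous L := L.continuous
  have := integral_torusMeasure_fderiv_eq_zero hd (by fun_prop) (fun k x => ?_) (Pi.single k 1)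
  · simp only [_root_.smul_apply, hL, dotProduct_single_one, smul_eq_mul] at this
    rw [integral_mul_const] at this
    refine (mul_eq_zero.1 this).resolve_right ?_
    simpa [Real.pi_ne_zero] using hk
  · obtain ⟨m, hm⟩ := hu k
    rw [map_add, hL (Pi.single k 1), dotProduct_single_one, hm, mul_add, mul_comm (2 * π) (m : ℝ),
      Real.sin_add_int_mul_two_pi]

theorem hasDerivAt_gaussianPDFReal_standard (x : ℝ) :
    HasDerivAt (gaussianPDFReal 0 1) (-x * gaussianPDFReal 0 1 x) x := by
  have h : HasDerivAt (fun y : ℝ => -(y - 0) ^ 2 / (2 * ((1 : NNReal) : ℝ))) (-x) x := by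
    refine ((((hasDerivAt_id x).sub_const 0).pow 2).neg.div_const
      (2 * ((1 : NNReal) : ℝ))).congr_deriv ?_
    simp
    ring
  refine (h.exp.const_mul (√(2 * π * ((1 : NNReal) : ℝ)))⁻¹).congr_deriv ?_
  simp only [gaussianPDFReal]
  ring

theorem integrable_mul_gaussianPDFReal_standard :
    Integrable fun x : ℝ => x * gaussianPDFReal 0 1 x := by
  have h := (integrable_mul_exp_neg_mul_sq (b := 1 / 2) (by norm_num)).const_mul
    (√(2 * π * ((1 : NNReal) : ℝ)))⁻¹
  refine h.congr (Filter.Eventually.of_forall fun x => ?_)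
  simp only [gaussianPDFReal, NNReal.coe_one, sub_zero]
  rw [show -x ^ 2 / (2 * 1) = -(1 / 2) * x ^ 2 by ring]
  ring

theorem tendsto_gaussianPDFReal_standard_atTop :
    Filter.Tendsto (gaussianPDFReal 0 1) Filter.atTop (nhds 0) :=
  tendsto_zero_of_hasDerivAt_of_integrableOn_Ioi (a := 0)
    (fun x _ => hasDerivAt_gaussianPDFReal_standard x)
    (by simpa [neg_mul] using integrable_mul_gaussianPDFReal_standard.neg.integrableOn)
    (integrable_gaussianPDFReal 0 1).integrableOn

theorem tendsto_gaussianPDFReal_standard_atBot :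
    Filter.Tendsto (gaussianPDFReal 0 1) Filter.atBot (nhds 0) :=
  tendsto_zero_of_hasDerivAt_of_integrableOn_Iic (a := 0)
    (fun x _ => hasDerivAt_gaussianPDFReal_standard x)
    (by simpa [neg_mul] using integrable_mul_gaussianPDFReal_standard.neg.integrableOn)
    (integrable_gaussianPDFReal 0 1).integrableOn

theorem abs_mul_integral_Iic_gaussianPDFReal_le {h : ℝ → ℝ} (hb : ∀ t, |h t| ≤ 1) {w : ℝ}
    (hw : w ≤ 0) :
    |w * ∫ t in Set.Iic w, h t * gaussianPDFReal 0 1 t| ≤ gaussianPDFReal 0 1 w := by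
  have hint : IntegrableOn (fun t : ℝ => -t * gaussianPDFReal 0 1 t) (Set.Iic w) := by
    simpa [neg_mul] using integrable_mul_gaussianPDFReal_standard.neg.integrableOn
  have heq := integral_Iic_of_hasDerivAt_of_tendsto'
    (fun x _ => hasDerivAt_gaussianPDFReal_standard x) hint tendsto_gaussianPDFReal_standard_atBot
  rw [sub_zero] at heq
  rw [← heq, ← integral_const_mul, ← Real.norm_eq_abs]
  refine norm_integral_le_of_norm_le hint ?_
  filter_upwards [ae_restrict_mem measurableSet_Iic] with t ht
  have hp := gaussianPDFReal_nonneg 0 1 t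
  rw [Real.norm_eq_abs, abs_mul, abs_mul, abs_of_nonneg hp, abs_of_nonpos hw, ← mul_assoc]
  have ht' : t ≤ w := ht
  gcongr
  calc -w * |h t| ≤ -w * 1 := by gcongr; exacts [neg_nonneg.2 hw, hb t]
    _ ≤ -t := by linarith

theorem abs_mul_integral_Ioi_gaussianPDFReal_le {h : ℝ → ℝ} (hb : ∀ t, |h t| ≤ 1) {w : ℝ}
    (hw : 0 ≤ w) :
    |w * ∫ t in Set.Ioi w, h t * gaussianPDFReal 0 1 t| ≤ gaussianPDFReal 0 1 w := by
  have hint : IntegrableOn (fun t : ℝ => -t * gaussianPDFReal 0 1 t) (Set.Ioi w) := by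
    simpa [neg_mul] using integrable_mul_gaussianPDFReal_standard.neg.integrableOn
  have heq := integral_Ioi_of_hasDerivAt_of_tendsto'
    (fun x _ => hasDerivAt_gaussianPDFReal_standard x) hint tendsto_gaussianPDFReal_standard_atTop
  rw [zero_sub, ← neg_inj, neg_neg, ← integral_neg] at heq
  rw [← heq, ← integral_const_mul, ← Real.norm_eq_abs]
  refine norm_integral_le_of_norm_le hint.neg ?_
  filter_upwards [ae_restrict_mem measurableSet_Ioi] with t ht
  have hp := gaussianPDFReal_nonneg 0 1 t
  rw [Real.norm_eq_abs, abs_mul, abs_mul, abs_of_nonneg hp, abs_of_nonneg hw, ← mul_assoc,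
    neg_mul, neg_neg]
  have ht' : w < t := ht
  gcongr
  calc w * |h t| ≤ w * 1 := by gcongr; exact hb t
    _ ≤ t := by linarith

/-- The Stein equation `deriv φ w = w * φ w + h w` for a continuous function `h` bounded by `1` with
mean zero under the standard Gaussian has a solution `φ` whose derivative is bounded by `2`. -/
theorem exists_stein_solution {h : ℝ → ℝ} (hc : Continuous h) (hb : ∀ t, |h t| ≤ 1)
    (h0 : ∫ t, h t ∂(gaussianReal 0 1) = 0) :
    ∃ φ : ℝ → ℝ, (∀ w, HasDerivAt φ (w * φ w + h w) w) ∧ ∀ w, |w * φ w + h w| ≤ 2 := by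
  set p : ℝ → ℝ := gaussianPDFReal 0 1 with hp
  have hp0 : ∀ w, 0 < p w := fun w => gaussianPDFReal_pos 0 1 w one_ne_zero
  have hpc : Continuous p :=
    continuous_iff_continuousAt.2 fun x => (hasDerivAt_gaussianPDFReal_standard x).continuousAt
  have hint : Integrable fun t => h t * p t := by
    refine (integrable_gaussianPDFReal 0 1).bdd_mul hc.aestronglyMeasurable (c := 1)
      (Filter.Eventually.of_forall hb)
  have htot : ∫ t, h t * p t = 0 := by
    rw [integral_gaussianReal_eq_integral_smul one_ne_zero] at h0
    simpa [mul_comm, hp] using h0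
  have hd : ∀ w, HasDerivAt (fun w => ∫ t in Set.Iic w, h t * p t) (h w * p w) w := by
    intro w
    have h1 : (fun w => ∫ t in Set.Iic w, h t * p t)
        = fun w => (∫ t in Set.Iic 0, h t * p t) + ∫ t in (0 : ℝ)..w, h t * p t := by
      ext w
      rw [← intervalIntegral.integral_Iic_sub_Iic hint.integrableOn hint.integrableOn]
      ring
    rw [h1]
    exact ((hc.mul hpc).integral_hasStrictDerivAt 0 w).hasDerivAt.const_add _
  have hbound : ∀ w, |w * ∫ t in Set.Iic w, h t * p t| ≤ p w := by
    intro w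
    rcases le_total w 0 with hw | hw
    · exact abs_mul_integral_Iic_gaussianPDFReal_le hb hw
    · have h2 := integral_add_compl (measurableSet_Iic (a := w)) hint
      rw [htot, Set.compl_Iic] at h2
      rw [eq_neg_of_add_eq_zero_left h2, mul_neg, abs_neg]
      exact abs_mul_integral_Ioi_gaussianPDFReal_le hb hw
  refine ⟨fun w => (∫ t in Set.Iic w, h t * p t) / p w, fun w => ?_, fun w => ?_⟩
  · refine ((hd w).div (hasDerivAt_gaussianPDFReal_standard w) (hp0 w).ne').congr_deriv ?_
    have := (hp0 w).ne'
    rw [← hp]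
    field_simp
    ring
  · refine (abs_add_le _ _).trans ?_
    have h1 : |w * ((∫ t in Set.Iic w, h t * p t) / p w)| ≤ 1 := by
      rw [← mul_div_assoc, abs_div, abs_of_pos (hp0 w), div_le_one (hp0 w)]
      exact hbound w
    linarith [hb w]

theorem dTV_nonneg (μ ν : Measure ℝ) : 0 ≤ dTV μ ν :=
  Real.iSup_nonneg fun _ => abs_nonneg _

theorem abs_measure_sub_le_of_isClosed {μ ν : MeasureTheory.Measure ℝ} [IsProbabilityMeasure μ]
    [IsProbabilityMeasure ν] {K : ℝ}
    (hK : ∀ g : ℝ → ℝ, Continuous g → (∀ t, 0 ≤ g t) → (∀ t, g t ≤ 1) →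
      |∫ t, g t ∂μ - ∫ t, g t ∂ν| ≤ K) {F : Set ℝ} (hF : IsClosed F) :
    |μ.real F - ν.real F| ≤ K := by
  have hpos : ∀ n : ℕ, 0 < 1 / ((n : ℝ) + 1) := fun n => by positivity
  have hlim := tendsto_one_div_add_atTop_nhds_zero_nat (𝕜 := ℝ)
  refine le_of_tendsto
    ((tendsto_integral_thickenedIndicator_of_isClosed μ hF hpos hlim).sub
      (tendsto_integral_thickenedIndicator_of_isClosed ν hF hpos hlim)).abs
    (Filter.Eventually.of_forall fun n => hK _ ?_ ?_ ?_)
  · exact NNReal.continuous_coe.comp (thickenedIndicator (hpos n) F).continuous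
  · exact fun t => NNReal.coe_nonneg _
  · exact fun t => by exact_mod_cast thickenedIndicator_le_one (hpos n) F t

theorem dTV_le_of_forall_continuous {μ ν : MeasureTheory.Measure ℝ} [IsProbabilityMeasure μ]
    [IsProbabilityMeasure ν] {K : ℝ}
    (hK : ∀ g : ℝ → ℝ, Continuous g → (∀ t, 0 ≤ g t) → (∀ t, g t ≤ 1) →
      |∫ t, g t ∂μ - ∫ t, g t ∂ν| ≤ K) : dTV μ ν ≤ K := by
  have : Nonempty {s : Set ℝ // MeasurableSet s} := ⟨⟨∅, MeasurableSet.empty⟩⟩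
  refine ciSup_le fun ⟨s, hs⟩ => ?_
  change |μ.real s - ν.real s| ≤ K
  refine le_of_forall_pos_le_add fun η hη => ?_
  have hη' : ENNReal.ofReal η ≠ 0 := by simpa using hη
  obtain ⟨F, hFs, hFc, hF⟩ :=
    hs.exists_isClosed_sdiff_lt (measure_ne_top (μ + ν) s) hη'
  have hlt : μ.real (s \ F) + ν.real (s \ F) < η := by
    rw [← measureReal_add_apply]
    rw [Measure.real]
    exact (ENNReal.lt_ofReal_iff_toReal_lt (measure_ne_top _ _)).1 hF
  have h1 := abs_measure_sub_le_of_isClosed hK hFc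
  rw [measureReal_sdiff hFs hFc.measurableSet, measureReal_sdiff hFs hFc.measurableSet] at hlt
  have h2 : μ.real F ≤ μ.real s := measureReal_mono hFs
  have h3 : ν.real F ≤ ν.real s := measureReal_mono hFs
  rw [abs_le] at h1 ⊢
  constructor <;> linarith

/-- The Stein method: a bound on the total variation distance to the standard Gaussian. -/
theorem dTV_gaussianReal_le {μ : MeasureTheory.Measure ℝ} [IsProbabilityMeasure μ] {K : ℝ}
    (hK : ∀ h φ : ℝ → ℝ, Continuous h → (∀ t, |h t| ≤ 1) →
      (∀ w, HasDerivAt φ (w * φ w + h w) w) → (∀ w, |w * φ w + h w| ≤ 2) → |∫ t, h t ∂μ| ≤ K) :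
    dTV μ (gaussianReal 0 1) ≤ K := by
  refine dTV_le_of_forall_continuous fun g hg hg0 hg1 => ?_
  have hi : ∀ ν : MeasureTheory.Measure ℝ, IsProbabilityMeasure ν → Integrable g ν := fun ν _ =>
    Integrable.of_bound hg.aestronglyMeasurable 1 (Filter.Eventually.of_forall fun t => by
      rw [Real.norm_eq_abs, abs_of_nonneg (hg0 t)]; exact hg1 t)
  set c := ∫ t, g t ∂(gaussianReal 0 1) with hc
  have hc0 : 0 ≤ c := integral_nonneg hg0
  have hc1 : c ≤ 1 := by
    have := integral_mono (hi (gaussianReal 0 1) inferInstance) (integrable_const 1) hg1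
    simpa using this
  have hcont : Continuous fun t => g t - c := hg.sub continuous_const
  have hb : ∀ t, |g t - c| ≤ 1 := fun t =>
    abs_le.2 ⟨by linarith [hg0 t], by linarith [hg1 t]⟩
  have h0 : ∫ t, (g t - c) ∂(gaussianReal 0 1) = 0 := by
    rw [integral_sub (hi _ inferInstance) (integrable_const _)]
    simp [hc]
  obtain ⟨φ, hφ, hφb⟩ := exists_stein_solution hcont hb h0
  have := hK _ φ hcont hb hφ hφb
  rw [integral_sub (hi _ inferInstance) (integrable_const _)] at this
  simpa using this

section Sphere

variable {ι : Type*} [Fintype ι]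

instance isProbabilityMeasure_sphereUniform [Nonempty ι] :
    IsProbabilityMeasure (sphereUniform ι) := by
  constructor
  rw [sphereUniform, Measure.smul_apply, smul_eq_mul]
  refine ENNReal.inv_mul_cancel ?_ (measure_ne_top _ _)
  rw [Ne, Measure.measure_univ_eq_zero]
  exact Measure.toSphere_ne_zero _

theorem integrable_sphereUniform [Nonempty ι] {F : Metric.sphere (0 : EuclideanSpace ℝ ι) 1 → ℝ}
    (hF : Continuous F) : Integrable F (sphereUniform ι) :=
  hF.integrable_of_hasCompactSupport (HasCompactSupport.of_compactSpace F)

open scoped Pointwise in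
theorem integral_sphereUniform_comp_isometry
    (L : EuclideanSpace ℝ ι ≃ₗᵢ[ℝ] EuclideanSpace ℝ ι) {F : EuclideanSpace ℝ ι → ℝ}
    (hF : Continuous F) :
    ∫ θ, F (L (θ : EuclideanSpace ℝ ι)) ∂(sphereUniform ι)
      = ∫ θ, F (θ : EuclideanSpace ℝ ι) ∂(sphereUniform ι) := by
  let T : Metric.sphere (0 : EuclideanSpace ℝ ι) 1 → Metric.sphere (0 : EuclideanSpace ℝ ι) 1 :=
    fun θ => ⟨L θ, by simp⟩
  have hT : Continuous T := (L.continuous.comp continuous_subtype_val).subtype_mk _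
  have hmap : Measure.map T (sphereUniform ι) = sphereUniform ι := by
    rw [sphereUniform, Measure.map_smul]
    congr 1
    ext s hs
    rw [Measure.map_apply hT.measurable hs, Measure.toSphere_apply' _ hs,
      Measure.toSphere_apply' _ (hT.measurable hs)]
    congr 1
    rw [← L.measurePreserving.measure_preimage_emb L.toHomeomorph.measurableEmbedding
      (Set.Ioo (0 : ℝ) 1 • (Subtype.val '' s))]
    congr 1
    ext x
    simp only [Set.mem_smul, Set.mem_image, Set.mem_preimage]
    constructor
    · rintro ⟨r, hr, _, ⟨θ, hθ, rfl⟩, rfl⟩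
      exact ⟨r, hr, _, ⟨T θ, hθ, rfl⟩, by simp [T]⟩
    · rintro ⟨r, hr, _, ⟨θ, hθ, rfl⟩, h⟩
      have hmem : L.symm (θ : EuclideanSpace ℝ ι) ∈ Metric.sphere (0 : EuclideanSpace ℝ ι) 1 := by
        simp
      refine ⟨r, hr, _, ⟨⟨L.symm θ, hmem⟩, ?_, rfl⟩, ?_⟩
      · have : T ⟨L.symm θ, hmem⟩ = θ := Subtype.ext (L.apply_symm_apply _)
        rwa [this]
      · apply L.injective
        rw [← h, map_smul, L.apply_symm_apply]
  conv_rhs => rw [← hmap]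
  exact (integral_map hT.aemeasurable
    (hF.comp continuous_subtype_val).aestronglyMeasurable).symm

theorem integral_sphereUniform_inner_pow_four_congr {v w : EuclideanSpace ℝ ι} (h : ‖v‖ = ‖w‖) :
    ∫ θ, inner ℝ (θ : EuclideanSpace ℝ ι) v ^ 4 ∂(sphereUniform ι)
      = ∫ θ, inner ℝ (θ : EuclideanSpace ℝ ι) w ^ 4 ∂(sphereUniform ι) := by
  let R := (ℝ ∙ (v - w))ᗮ.reflection
  have hR : R v = w := Submodule.reflection_sub h
  rw [← integral_sphereUniform_comp_isometry R (F := fun x => inner ℝ x w ^ 4) (by fun_prop)]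
  refine integral_congr_ae (Filter.Eventually.of_forall fun θ => ?_)
  simp only
  rw [← hR, LinearIsometryEquiv.inner_map_map]

theorem exists_integral_sphereUniform_inner_pow_four [Nonempty ι] :
    ∃ A : ℝ, ∀ v : EuclideanSpace ℝ ι,
      ∫ θ, inner ℝ (θ : EuclideanSpace ℝ ι) v ^ 4 ∂(sphereUniform ι) = A * inner ℝ v v ^ 2 := by
  classical
  let e : EuclideanSpace ℝ ι := EuclideanSpace.single (Classical.arbitrary ι) 1
  have he : ‖e‖ = 1 := by simp [e]
  refine ⟨∫ θ, inner ℝ (θ : EuclideanSpace ℝ ι) e ^ 4 ∂(sphereUniform ι), fun v => ?_⟩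
  rw [integral_sphereUniform_inner_pow_four_congr (w := ‖v‖ • e) (by simp [norm_smul, he])]
  simp_rw [inner_smul_right, mul_pow]
  rw [integral_const_mul, real_inner_self_eq_norm_sq]
  ring

theorem exists_integral_sphereUniform_inner_mul [Nonempty ι] :
    ∃ A : ℝ, ∀ v₁ v₂ v₃ v₄ : EuclideanSpace ℝ ι,
      ∫ θ, inner ℝ (θ : EuclideanSpace ℝ ι) v₁ * inner ℝ (θ : EuclideanSpace ℝ ι) v₂ *
        (inner ℝ (θ : EuclideanSpace ℝ ι) v₃ * inner ℝ (θ : EuclideanSpace ℝ ι) v₄)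
          ∂(sphereUniform ι)
      = A * (inner ℝ v₁ v₂ * inner ℝ v₃ v₄ + inner ℝ v₁ v₃ * inner ℝ v₂ v₄ +
          inner ℝ v₁ v₄ * inner ℝ v₂ v₃) := by
  obtain ⟨A, hA⟩ := exists_integral_sphereUniform_inner_pow_four (ι := ι)
  refine ⟨A / 3, fun v₁ v₂ v₃ v₄ => ?_⟩
  have hpol : ∀ θ : Metric.sphere (0 : EuclideanSpace ℝ ι) 1,
      inner ℝ (θ : EuclideanSpace ℝ ι) v₁ * inner ℝ (θ : EuclideanSpace ℝ ι) v₂ *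
        (inner ℝ (θ : EuclideanSpace ℝ ι) v₃ * inner ℝ (θ : EuclideanSpace ℝ ι) v₄) =
      (1 / 192) * (((inner ℝ (θ : EuclideanSpace ℝ ι) (v₁ + v₂ + v₃ + v₄) ^ 4
        - inner ℝ (θ : EuclideanSpace ℝ ι) (v₁ + v₂ + v₃ - v₄) ^ 4)
        - (inner ℝ (θ : EuclideanSpace ℝ ι) (v₁ + v₂ - v₃ + v₄) ^ 4
        - inner ℝ (θ : EuclideanSpace ℝ ι) (v₁ + v₂ - v₃ - v₄) ^ 4))
        - ((inner ℝ (θ : EuclideanSpace ℝ ι) (v₁ - v₂ + v₃ + v₄) ^ 4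
        - inner ℝ (θ : EuclideanSpace ℝ ι) (v₁ - v₂ + v₃ - v₄) ^ 4)
        - (inner ℝ (θ : EuclideanSpace ℝ ι) (v₁ - v₂ - v₃ + v₄) ^ 4
        - inner ℝ (θ : EuclideanSpace ℝ ι) (v₁ - v₂ - v₃ - v₄) ^ 4))) := by
    intro θ
    simp only [inner_add_right, inner_sub_right]
    ring
  simp_rw [hpol]
  rw [integral_const_mul, integral_sub, integral_sub, integral_sub, integral_sub, integral_sub,
    integral_sub, integral_sub]
  rotate_left
  iterate 14 exact integrable_sphereUniform (by fun_prop)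
  simp only [hA]
  simp only [inner_add_right, inner_sub_right, inner_add_left, inner_sub_left]
  rw [real_inner_comm v₁ v₂, real_inner_comm v₁ v₃, real_inner_comm v₁ v₄,
    real_inner_comm v₂ v₃, real_inner_comm v₂ v₄, real_inner_comm v₃ v₄]
  ring

theorem integral_sphereUniform_coord_mul [Nonempty ι] [DecidableEq ι] (i j k l : ι) :
    ∫ θ, (θ : EuclideanSpace ℝ ι) i * (θ : EuclideanSpace ℝ ι) j *
        ((θ : EuclideanSpace ℝ ι) k * (θ : EuclideanSpace ℝ ι) l) ∂(sphereUniform ι)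
      = ((Fintype.card ι : ℝ) * (Fintype.card ι + 2))⁻¹ *
        ((if i = j then 1 else 0) * (if k = l then 1 else 0) +
          (if i = k then 1 else 0) * (if j = l then 1 else 0) +
          (if i = l then 1 else 0) * (if j = k then 1 else 0)) := by
  obtain ⟨A, hA⟩ := exists_integral_sphereUniform_inner_mul (ι := ι)
  have hcoord : ∀ i j k l : ι, ∫ θ, (θ : EuclideanSpace ℝ ι) i * (θ : EuclideanSpace ℝ ι) j *
        ((θ : EuclideanSpace ℝ ι) k * (θ : EuclideanSpace ℝ ι) l) ∂(sphereUniform ι)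
      = A * ((if i = j then 1 else 0) * (if k = l then 1 else 0) +
          (if i = k then 1 else 0) * (if j = l then 1 else 0) +
          (if i = l then 1 else 0) * (if j = k then 1 else 0)) := by
    intro i j k l
    have := hA (EuclideanSpace.single i 1) (EuclideanSpace.single j 1) (EuclideanSpace.single k 1)
      (EuclideanSpace.single l 1)
    simpa [EuclideanSpace.inner_single_right, eq_comm] using this
  have hnorm : ∀ θ : Metric.sphere (0 : EuclideanSpace ℝ ι) 1,
      ∑ i, ∑ k, (θ : EuclideanSpace ℝ ι) i * (θ : EuclideanSpace ℝ ι) i *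
        ((θ : EuclideanSpace ℝ ι) k * (θ : EuclideanSpace ℝ ι) k) = 1 := by
    intro θ
    have h1 : ∑ i, (θ : EuclideanSpace ℝ ι) i * (θ : EuclideanSpace ℝ ι) i = 1 := by
      have := EuclideanSpace.real_norm_sq_eq (θ : EuclideanSpace ℝ ι)
      rw [norm_eq_of_mem_sphere θ] at this
      simpa [pow_two] using this.symm
    rw [← Finset.sum_mul_sum, h1, one_mul]
  have htot : ∑ i : ι, ∑ k : ι, A * ((if i = i then (1 : ℝ) else 0) * (if k = k then 1 else 0) +
          (if i = k then 1 else 0) * (if i = k then 1 else 0) +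
          (if i = k then 1 else 0) * (if i = k then 1 else 0)) = 1 := by
    have hi : ∀ i k : ι, Integrable (fun θ : Metric.sphere (0 : EuclideanSpace ℝ ι) 1 =>
        (θ : EuclideanSpace ℝ ι) i * (θ : EuclideanSpace ℝ ι) i *
        ((θ : EuclideanSpace ℝ ι) k * (θ : EuclideanSpace ℝ ι) k)) (sphereUniform ι) :=
      fun i k => integrable_sphereUniform (by fun_prop)
    rw [Finset.sum_congr rfl fun i _ => (Finset.sum_congr rfl fun k _ =>
        (hcoord i i k k).symm).trans (integral_finsetSum _ fun k _ => hi i k).symm,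
      ← integral_finsetSum _ fun i _ => integrable_finsetSum _ fun k _ => hi i k]
    simp_rw [hnorm]
    simp
  have hA1 : A * ((Fintype.card ι : ℝ) * (Fintype.card ι + 2)) = 1 := by
    rw [← htot]
    simp [← Finset.mul_sum, Finset.sum_add_distrib]
    ring
  rw [hcoord, eq_inv_of_mul_eq_one_left hA1]

theorem sum_mul_integral_sphereUniform_coord_mul [Nonempty ι] {K : ι → ι → ℝ}
    (hK : ∀ i j, K i j = K j i) :
    ∑ i, ∑ j, ∑ k, ∑ l, K i j * K k l *
      ∫ θ, (θ : EuclideanSpace ℝ ι) i * (θ : EuclideanSpace ℝ ι) j *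
        ((θ : EuclideanSpace ℝ ι) k * (θ : EuclideanSpace ℝ ι) l) ∂(sphereUniform ι)
      = ((Fintype.card ι : ℝ) * (Fintype.card ι + 2))⁻¹ *
        ((∑ i, K i i) ^ 2 + 2 * ∑ i, ∑ j, K i j ^ 2) := by
  classical
  simp_rw [integral_sphereUniform_coord_mul, mul_left_comm _ (_ * _)⁻¹, ← Finset.mul_sum]
  congr 1
  simp_rw [mul_add, Finset.sum_add_distrib]
  have h1 : ∑ i, ∑ j, ∑ k, ∑ l, K i j * K k l *
      ((if i = j then (1 : ℝ) else 0) * (if k = l then 1 else 0)) = (∑ i, K i i) ^ 2 := by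
    simp [pow_two, Finset.sum_mul_sum]
  have h2 : ∑ i, ∑ j, ∑ k, ∑ l, K i j * K k l *
      ((if i = k then (1 : ℝ) else 0) * (if j = l then 1 else 0)) = ∑ i, ∑ j, K i j ^ 2 := by
    simp [pow_two]
  have h3 : ∑ i, ∑ j, ∑ k, ∑ l, K i j * K k l *
      ((if i = l then (1 : ℝ) else 0) * (if j = k then 1 else 0)) = ∑ i, ∑ j, K i j ^ 2 := by
    simp [pow_two, hK _]
  rw [h1, h2, h3]
  ring

theorem sq_sum_sum_mul_mul (t : ι → ℝ) (K : ι → ι → ℝ) :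
    (∑ i, ∑ j, t i * t j * K i j) ^ 2 =
      ∑ i, ∑ j, ∑ k, ∑ l, (t i * t j * (t k * t l)) * (K i j * K k l) := by
  simp_rw [pow_two, Finset.sum_mul, Finset.mul_sum]
  refine Finset.sum_congr rfl fun i _ => Finset.sum_congr rfl fun j _ =>
    Finset.sum_congr rfl fun k _ => Finset.sum_congr rfl fun l _ => by ring

/-- The second moment of a symmetric quadratic form under the uniform measure on the sphere. -/
theorem integral_sphereUniform_sq_quadraticForm [Nonempty ι] {K : ι → ι → ℝ}
    (hK : ∀ i j, K i j = K j i) :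
    ∫ θ, (∑ i, ∑ j, (θ : EuclideanSpace ℝ ι) i * (θ : EuclideanSpace ℝ ι) j * K i j) ^ 2
        ∂(sphereUniform ι)
      = ((Fintype.card ι : ℝ) * (Fintype.card ι + 2))⁻¹ *
        ((∑ i, K i i) ^ 2 + 2 * ∑ i, ∑ j, K i j ^ 2) := by
  rw [← sum_mul_integral_sphereUniform_coord_mul hK]
  have hi : ∀ i j k l : ι, Integrable (fun θ : Metric.sphere (0 : EuclideanSpace ℝ ι) 1 =>
      (θ : EuclideanSpace ℝ ι) i * (θ : EuclideanSpace ℝ ι) j *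
        ((θ : EuclideanSpace ℝ ι) k * (θ : EuclideanSpace ℝ ι) l) * (K i j * K k l))
      (sphereUniform ι) := fun i j k l => integrable_sphereUniform (by fun_prop)
  simp_rw [sq_sum_sum_mul_mul (fun i => _ )]
  rw [integral_finsetSum _ fun i _ => integrable_finsetSum _ fun j _ =>
      integrable_finsetSum _ fun k _ => integrable_finsetSum _ fun l _ => hi i j k l]
  refine Finset.sum_congr rfl fun i _ => ?_
  rw [integral_finsetSum _ fun j _ =>
      integrable_finsetSum _ fun k _ => integrable_finsetSum _ fun l _ => hi i j k l]
  refine Finset.sum_congr rfl fun j _ => ?_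
  rw [integral_finsetSum _ fun k _ => integrable_finsetSum _ fun l _ => hi i j k l]
  refine Finset.sum_congr rfl fun k _ => ?_
  rw [integral_finsetSum _ fun l _ => hi i j k l]
  refine Finset.sum_congr rfl fun l _ => ?_
  rw [integral_mul_const, mul_comm]

end Sphere

section Torus

variable {n : ℕ} {ι : Type*}

/-- The real trigonometric polynomial with coefficients `a` and frequencies `u`. -/
noncomputable def trigSum [Fintype ι] (u : ι → Fin n → ℝ) (a : ι → ℝ) (x : Fin n → ℝ) : ℝ :=
  ∑ i, a i * Real.cos (2 * π * (u i ⬝ᵥ x))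

open Classical in
/-- The symmetric matrix of the quadratic form in the coefficients `a` measuring the deviation of
the normalized squared gradient of `trigSum u a` from its mean. -/
noncomputable def steinMatrix (u : ι → Fin n → ℝ) (x : Fin n → ℝ) (i j : ι) : ℝ :=
  (u i ⬝ᵥ u j) / 2 * (Real.sin (2 * π * (u i ⬝ᵥ x)) * Real.sin (2 * π * (u j ⬝ᵥ x)))
    - if i = j then 1 / 2 else 0

theorem continuous_trigSum [Fintype ι] (u : ι → Fin n → ℝ) (a : ι → ℝ) :
    Continuous (trigSum u a) := by
  unfold trigSum dotProduct
  fun_prop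

theorem continuous_steinMatrix (u : ι → Fin n → ℝ) (i j : ι) :
    Continuous fun x => steinMatrix u x i j := by
  unfold steinMatrix dotProduct
  fun_prop

theorem steinMatrix_comm (u : ι → Fin n → ℝ) (x : Fin n → ℝ) (i j : ι) :
    steinMatrix u x i j = steinMatrix u x j i := by
  by_cases h : i = j
  · rw [h]
  · rw [steinMatrix, steinMatrix, if_neg h, if_neg (Ne.symm h), dotProduct_comm (u i),
      mul_comm (Real.sin (2 * π * (u i ⬝ᵥ x)))]

theorem sum_mul_steinMatrix [Fintype ι] {u : ι → Fin n → ℝ} {a : ι → ℝ} (ha : ∑ i, a i ^ 2 = 2)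
    (x : Fin n → ℝ) :
    ∑ i, ∑ j, a i * a j * steinMatrix u x i j =
      (∑ i, ∑ j, a i * a j * ((u i ⬝ᵥ u j) / 2 *
        (Real.sin (2 * π * (u i ⬝ᵥ x)) * Real.sin (2 * π * (u j ⬝ᵥ x))))) - 1 := by
  classical
  simp only [steinMatrix, mul_sub, Finset.sum_sub_distrib]
  congr 1
  simp only [mul_ite, mul_zero, Finset.sum_ite_eq, Finset.mem_univ, if_true]
  rw [← Finset.sum_mul]
  simp_rw [← pow_two, ha]
  norm_num

/-- Integration by parts on the torus for the Stein equation. -/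
theorem integral_torusMeasure_trigSum_stein [Fintype ι] {u : ι → Fin n → ℝ}
    (hu : ∀ i k, ∃ m : ℤ, u i k = m) (hu2 : ∀ i, u i ⬝ᵥ u i = 2) {a : ι → ℝ}
    (ha : ∑ i, a i ^ 2 = 2) {h φ : ℝ → ℝ}
    (hc : Continuous h) (hφ : ∀ w, HasDerivAt φ (w * φ w + h w) w) :
    ∫ x, h (trigSum u a x) ∂(torusMeasure n) =
      -∫ x, (trigSum u a x * φ (trigSum u a x) + h (trigSum u a x)) *
        ∑ i, ∑ j, a i * a j * steinMatrix u x i j ∂(torusMeasure n) := by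
  have hφc : Continuous φ := continuous_iff_continuousAt.2 fun x => (hφ x).continuousAt
  have hfc := continuous_trigSum u a
  let L : ι → (Fin n → ℝ) →L[ℝ] ℝ :=
    fun i => LinearMap.toContinuousLinearMap (dotProductBilin ℝ ℝ (u i))
  have hL : ∀ i x, L i x = u i ⬝ᵥ x := fun i x => rfl
  have hLc : ∀ i, Continuous (L i) := fun i => (L i).continuous
  let F' : (Fin n → ℝ) → (Fin n → ℝ) →L[ℝ] ℝ :=
    fun x => ∑ i, a i • (-Real.sin (2 * π * L i x)) • (2 * π) • L i
  have hF'c : Continuous F' := by fun_prop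
  have hf : ∀ x, HasFDerivAt (trigSum u a) (F' x) x := fun x =>
    HasFDerivAt.fun_sum fun i _ => (((L i).hasFDerivAt.const_mul (2 * π)).cos).const_mul (a i)
  have hper : ∀ i k x, L i (x + Pi.single k 1) = L i x + u i k := by
    intro i k x
    rw [map_add, hL i (Pi.single k 1), dotProduct_single_one]
  have hfper : ∀ k x, trigSum u a (x + Pi.single k 1) = trigSum u a x := by
    intro k x
    refine Finset.sum_congr rfl fun i _ => ?_
    obtain ⟨m, hm⟩ := hu i k
    rw [← hL, ← hL, hper, hm, mul_add, mul_comm (2 * π) (m : ℝ), Real.cos_add_int_mul_two_pi]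
  have key : ∀ i, ∫ x, (Real.sin (2 * π * L i x) •
      ((trigSum u a x * φ (trigSum u a x) + h (trigSum u a x)) • F' x) +
      φ (trigSum u a x) • (Real.cos (2 * π * L i x) • (2 * π) • L i)) (u i)
        ∂(torusMeasure n) = 0 := by
    intro i
    refine integral_torusMeasure_fderiv_eq_zero
      (G := fun x => Real.sin (2 * π * L i x) * φ (trigSum u a x)) (fun x => ?_) ?_ ?_ (u i)
    · exact (((L i).hasFDerivAt.const_mul (2 * π)).sin).mul ((hφ _).comp_hasFDerivAt x (hf x))
    · fun_prop
    · intro k x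
      obtain ⟨m, hm⟩ := hu i k
      rw [hfper, hper, hm, mul_add, mul_comm (2 * π) (m : ℝ), Real.sin_add_int_mul_two_pi]
  have hsum : ∑ i, a i * ∫ x, (Real.sin (2 * π * L i x) •
      ((trigSum u a x * φ (trigSum u a x) + h (trigSum u a x)) • F' x) +
      φ (trigSum u a x) • (Real.cos (2 * π * L i x) • (2 * π) • L i)) (u i)
        ∂(torusMeasure n) = 0 :=
    Finset.sum_eq_zero fun i _ => by rw [key, mul_zero]
  simp_rw [← integral_const_mul] at hsum
  rw [← integral_finsetSum _ fun i _ => integrable_torusMeasure_of_continuous (by fun_prop)] at hsum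
  have hpt : ∀ x, ∑ i, a i * (Real.sin (2 * π * L i x) •
      ((trigSum u a x * φ (trigSum u a x) + h (trigSum u a x)) • F' x) +
      φ (trigSum u a x) • (Real.cos (2 * π * L i x) • (2 * π) • L i)) (u i) =
      -(4 * π) * (h (trigSum u a x) +
        (trigSum u a x * φ (trigSum u a x) + h (trigSum u a x)) *
          ∑ i, ∑ j, a i * a j * steinMatrix u x i j) := by
    intro x
    have h1 : ∀ i, F' x (u i) =
        -(2 * π) * ∑ j, a j * ((u i ⬝ᵥ u j) * Real.sin (2 * π * (u j ⬝ᵥ x))) := by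
      intro i
      simp only [F', _root_.sum_apply, _root_.smul_apply, smul_eq_mul, hL, Finset.mul_sum]
      refine Finset.sum_congr rfl fun j _ => ?_
      rw [dotProduct_comm (u i) (u j)]
      ring
    have h2 : ∑ i, ∑ j, a i * a j * ((u i ⬝ᵥ u j) / 2 *
        (Real.sin (2 * π * (u i ⬝ᵥ x)) * Real.sin (2 * π * (u j ⬝ᵥ x)))) =
        ∑ i, a i * Real.sin (2 * π * (u i ⬝ᵥ x)) / 2 *
          ∑ j, a j * ((u i ⬝ᵥ u j) * Real.sin (2 * π * (u j ⬝ᵥ x))) := by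
      refine Finset.sum_congr rfl fun i _ => ?_
      rw [Finset.mul_sum]
      exact Finset.sum_congr rfl fun j _ => by ring
    rw [sum_mul_steinMatrix ha, h2]
    simp only [_root_.add_apply, _root_.smul_apply, smul_eq_mul, h1, hL, hu2]
    have h3 : ∀ (S : ι → ℝ) (p q : ℝ), ∑ i, a i * (Real.sin (2 * π * (u i ⬝ᵥ x)) *
        (p * (-(2 * π) * S i)) + q * (Real.cos (2 * π * (u i ⬝ᵥ x)) * (2 * π * 2))) =
        -(4 * π) * p * ∑ i, a i * Real.sin (2 * π * (u i ⬝ᵥ x)) / 2 * S i +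
          4 * π * q * trigSum u a x := by
      intro S p q
      rw [trigSum, Finset.mul_sum, Finset.mul_sum, ← Finset.sum_add_distrib]
      exact Finset.sum_congr rfl fun i _ => by ring
    rw [h3]
    ring
  simp_rw [hpt] at hsum
  rw [integral_const_mul] at hsum
  have h0 := (mul_eq_zero.1 hsum).resolve_left (by simp [Real.pi_ne_zero])
  rw [integral_add (integrable_torusMeasure_of_continuous (by fun_prop))
    (integrable_torusMeasure_of_continuous ?_)] at h0
  · linarith
  · have := continuous_steinMatrix u
    fun_prop

/-- The law of a normalized trigonometric sum is close to the standard Gaussian in total variation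
as soon as the quadratic form of `steinMatrix` is small in mean. -/
theorem dTV_map_trigSum_le [Fintype ι] {u : ι → Fin n → ℝ} (hu : ∀ i k, ∃ m : ℤ, u i k = m)
    (hu2 : ∀ i, u i ⬝ᵥ u i = 2) {a : ι → ℝ} (ha : ∑ i, a i ^ 2 = 2) :
    dTV (Measure.map (trigSum u a) (torusMeasure n)) (gaussianReal 0 1) ≤
      2 * ∫ x, |∑ i, ∑ j, a i * a j * steinMatrix u x i j| ∂(torusMeasure n) := by
  have hfc := continuous_trigSum u a
  have := Measure.isProbabilityMeasure_map (μ := torusMeasure n) hfc.aemeasurable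
  refine dTV_gaussianReal_le fun h φ hc _ hφ hφb => ?_
  rw [integral_map hfc.aemeasurable hc.aestronglyMeasurable,
    integral_torusMeasure_trigSum_stein hu hu2 ha hc hφ, abs_neg, ← integral_const_mul,
    ← Real.norm_eq_abs]
  have hM := continuous_steinMatrix u
  refine norm_integral_le_of_norm_le (integrable_torusMeasure_of_continuous (by fun_prop))
    (Filter.Eventually.of_forall fun x => ?_)
  rw [Real.norm_eq_abs, abs_mul]
  gcongr
  exact hφb _

theorem integral_torusMeasure_cos_mul_cos_eq_zero {u v : Fin n → ℝ} (hu : ∀ k, ∃ m : ℤ, u k = m)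
    (hv : ∀ k, ∃ m : ℤ, v k = m) (hadd : u + v ≠ 0) (hsub : u - v ≠ 0) :
    ∫ x, Real.cos (2 * (2 * π * (u ⬝ᵥ x))) * Real.cos (2 * (2 * π * (v ⬝ᵥ x))) ∂(torusMeasure n)
      = 0 := by
  have hcos : ∀ w : Fin n → ℝ, Continuous fun x => Real.cos (2 * π * (w ⬝ᵥ x)) := by
    intro w
    unfold dotProduct
    fun_prop
  have h1 : ∀ x, Real.cos (2 * (2 * π * (u ⬝ᵥ x))) * Real.cos (2 * (2 * π * (v ⬝ᵥ x))) =
      1 / 2 * (Real.cos (2 * π * (((2 : ℝ) • (u + v)) ⬝ᵥ x)) +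
        Real.cos (2 * π * (((2 : ℝ) • (u - v)) ⬝ᵥ x))) := by
    intro x
    rw [smul_dotProduct, smul_dotProduct, add_dotProduct, sub_dotProduct, smul_eq_mul, smul_eq_mul,
      show 2 * π * (2 * (u ⬝ᵥ x + v ⬝ᵥ x)) = 2 * (2 * π * (u ⬝ᵥ x)) + 2 * (2 * π * (v ⬝ᵥ x)) by ring,
      show 2 * π * (2 * (u ⬝ᵥ x - v ⬝ᵥ x)) = 2 * (2 * π * (u ⬝ᵥ x)) - 2 * (2 * π * (v ⬝ᵥ x)) by ring,
      Real.cos_add, Real.cos_sub]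
    ring
  simp_rw [h1]
  rw [integral_const_mul, integral_add (integrable_torusMeasure_of_continuous (hcos _))
      (integrable_torusMeasure_of_continuous (hcos _)),
    integral_torusMeasure_cos_eq_zero _ (smul_ne_zero two_ne_zero hadd),
    integral_torusMeasure_cos_eq_zero _ (smul_ne_zero two_ne_zero hsub)]
  · norm_num
  · intro k
    obtain ⟨p, hp⟩ := hu k
    obtain ⟨q, hq⟩ := hv k
    exact ⟨2 * (p - q), by simp [hp, hq]⟩
  · intro k
    obtain ⟨p, hp⟩ := hu k
    obtain ⟨q, hq⟩ := hv k
    exact ⟨2 * (p + q), by simp [hp, hq]⟩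

theorem integral_torusMeasure_sq_trace_steinMatrix_le [Fintype ι] {u : ι → Fin n → ℝ}
    (hu : ∀ i k, ∃ m : ℤ, u i k = m) (hu2 : ∀ i, u i ⬝ᵥ u i = 2)
    (hinj : Function.Injective u) (hadd : ∀ i j, u i + u j ≠ 0) :
    ∫ x, (∑ i, steinMatrix u x i i) ^ 2 ∂(torusMeasure n) ≤ Fintype.card ι / 4 := by
  have hcc : ∀ i j, Continuous fun x : Fin n → ℝ =>
      Real.cos (2 * (2 * π * (u i ⬝ᵥ x))) * Real.cos (2 * (2 * π * (u j ⬝ᵥ x))) := by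
    intro i j
    unfold dotProduct
    fun_prop
  have h1 : ∀ x, (∑ i, steinMatrix u x i i) ^ 2 = 1 / 4 * ∑ i, ∑ j,
      Real.cos (2 * (2 * π * (u i ⬝ᵥ x))) * Real.cos (2 * (2 * π * (u j ⬝ᵥ x))) := by
    intro x
    have h2 : ∀ i, steinMatrix u x i i = -(1 / 2) * Real.cos (2 * (2 * π * (u i ⬝ᵥ x))) := by
      intro i
      rw [steinMatrix, if_pos rfl, hu2, Real.cos_two_mul, Real.cos_sq']
      ring
    simp_rw [h2]
    rw [← Finset.mul_sum, mul_pow, pow_two (∑ i, _), Finset.sum_mul_sum]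
    norm_num
  simp_rw [h1]
  rw [integral_const_mul, integral_finsetSum _ fun i _ => integrable_finsetSum _ fun j _ =>
    integrable_torusMeasure_of_continuous (hcc i j)]
  have h3 : ∀ i, ∫ x, ∑ j, Real.cos (2 * (2 * π * (u i ⬝ᵥ x))) *
      Real.cos (2 * (2 * π * (u j ⬝ᵥ x))) ∂(torusMeasure n) ≤ 1 := by
    intro i
    rw [integral_finsetSum _ fun j _ => integrable_torusMeasure_of_continuous (hcc i j),
      Finset.sum_eq_single i]
    · have := integral_mono (μ := torusMeasure n) (integrable_torusMeasure_of_continuous (hcc i i))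
        (integrable_const 1) fun x => ?_
      · simpa using this
      · simp only [← pow_two]
        exact Real.cos_sq_le_one _
    · intro j _ hj
      exact integral_torusMeasure_cos_mul_cos_eq_zero (hu i) (hu j) (hadd i j)
        (sub_ne_zero.2 fun h => hj (hinj h).symm)
    · simp
  calc _ ≤ 1 / 4 * ∑ _i : ι, (1 : ℝ) := by
        gcongr with i
        exact h3 i
    _ = _ := by simp; ring

theorem sq_steinMatrix_le {u : ι → Fin n → ℝ} (hu2 : ∀ i, u i ⬝ᵥ u i = 2) (x : Fin n → ℝ)
    (i j : ι) : steinMatrix u x i j ^ 2 ≤ (u i ⬝ᵥ u j) ^ 2 / 4 := by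
  by_cases h : i = j
  · subst h
    rw [steinMatrix, if_pos rfl, hu2]
    have h1 := Real.sin_sq_le_one (2 * π * (u i ⬝ᵥ x))
    have h2 := sq_nonneg (Real.sin (2 * π * (u i ⬝ᵥ x)))
    nlinarith
  · rw [steinMatrix, if_neg h, sub_zero, mul_pow, mul_pow, div_pow]
    have h1 : Real.sin (2 * π * (u i ⬝ᵥ x)) ^ 2 * Real.sin (2 * π * (u j ⬝ᵥ x)) ^ 2 ≤ 1 :=
      mul_le_one₀ (Real.sin_sq_le_one _) (sq_nonneg _) (Real.sin_sq_le_one _)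
    calc _ ≤ (u i ⬝ᵥ u j) ^ 2 / 2 ^ 2 * 1 := by gcongr
      _ = _ := by ring

theorem integrable_uncurry_sq_steinMatrix [Fintype ι] [Nonempty ι] (u : ι → Fin n → ℝ) :
    Integrable (Function.uncurry fun (θ : Metric.sphere (0 : EuclideanSpace ℝ ι) 1)
      (x : Fin n → ℝ) => (∑ i, ∑ j, (θ : EuclideanSpace ℝ ι) i * (θ : EuclideanSpace ℝ ι) j *
        steinMatrix u x i j) ^ 2) ((sphereUniform ι).prod (torusMeasure n)) := by
  have hM := continuous_steinMatrix u
  have hfun : (Function.uncurry fun (θ : Metric.sphere (0 : EuclideanSpace ℝ ι) 1)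
      (x : Fin n → ℝ) => (∑ i, ∑ j, (θ : EuclideanSpace ℝ ι) i * (θ : EuclideanSpace ℝ ι) j *
      steinMatrix u x i j) ^ 2) = fun z => ∑ i, ∑ j, ∑ k, ∑ l,
        ((z.1 : EuclideanSpace ℝ ι) i * (z.1 : EuclideanSpace ℝ ι) j *
          ((z.1 : EuclideanSpace ℝ ι) k * (z.1 : EuclideanSpace ℝ ι) l)) *
        (steinMatrix u z.2 i j * steinMatrix u z.2 k l) := by
    ext z
    exact sq_sum_sum_mul_mul (fun i => (z.1 : EuclideanSpace ℝ ι) i) (steinMatrix u z.2)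
  rw [hfun]
  refine integrable_finsetSum _ fun i _ => integrable_finsetSum _ fun j _ =>
    integrable_finsetSum _ fun k _ => integrable_finsetSum _ fun l _ => ?_
  have hθ : Integrable (fun θ : Metric.sphere (0 : EuclideanSpace ℝ ι) 1 =>
      (θ : EuclideanSpace ℝ ι) i * (θ : EuclideanSpace ℝ ι) j *
        ((θ : EuclideanSpace ℝ ι) k * (θ : EuclideanSpace ℝ ι) l)) (sphereUniform ι) :=
    integrable_sphereUniform (by fun_prop)
  have hx : Integrable (fun x => steinMatrix u x i j * steinMatrix u x k l) (torusMeasure n) :=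
    integrable_torusMeasure_of_continuous ((hM i j).mul (hM k l))
  exact hθ.mul_prod hx

theorem integral_sphereUniform_integral_torusMeasure_sq_le [Fintype ι] [Nonempty ι]
    {u : ι → Fin n → ℝ} (hu : ∀ i k, ∃ m : ℤ, u i k = m) (hu2 : ∀ i, u i ⬝ᵥ u i = 2)
    (hinj : Function.Injective u) (hadd : ∀ i j, u i + u j ≠ 0) :
    ∫ θ, ∫ x, (∑ i, ∑ j, (θ : EuclideanSpace ℝ ι) i * (θ : EuclideanSpace ℝ ι) j *
        steinMatrix u x i j) ^ 2 ∂(torusMeasure n) ∂(sphereUniform ι) ≤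
      ((Fintype.card ι : ℝ) * (Fintype.card ι + 2))⁻¹ *
        (Fintype.card ι / 4 + (∑ i, ∑ j, (u i ⬝ᵥ u j) ^ 2) / 2) := by
  have hM := continuous_steinMatrix u
  rw [integral_integral_swap (integrable_uncurry_sq_steinMatrix u)]
  have hinner : ∀ x, ∫ θ, (∑ i, ∑ j, (θ : EuclideanSpace ℝ ι) i * (θ : EuclideanSpace ℝ ι) j *
        steinMatrix u x i j) ^ 2 ∂(sphereUniform ι) =
      ((Fintype.card ι : ℝ) * (Fintype.card ι + 2))⁻¹ *
        ((∑ i, steinMatrix u x i i) ^ 2 + 2 * ∑ i, ∑ j, steinMatrix u x i j ^ 2) :=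
    fun x => integral_sphereUniform_sq_quadraticForm (steinMatrix_comm u x)
  simp_rw [hinner]
  rw [integral_const_mul, integral_add (integrable_torusMeasure_of_continuous (by fun_prop))
    (integrable_torusMeasure_of_continuous (by fun_prop))]
  have h2 : ∫ x, 2 * ∑ i, ∑ j, steinMatrix u x i j ^ 2 ∂(torusMeasure n) ≤
      (∑ i, ∑ j, (u i ⬝ᵥ u j) ^ 2) / 2 := by
    have := integral_mono (μ := torusMeasure n)
      (f := fun x => 2 * ∑ i, ∑ j, steinMatrix u x i j ^ 2)
      (g := fun _ => 2 * ∑ i, ∑ j, (u i ⬝ᵥ u j) ^ 2 / 4)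
      (integrable_torusMeasure_of_continuous (by fun_prop)) (integrable_const _) fun x => by
        simp only
        gcongr with i _ j _
        exact sq_steinMatrix_le hu2 x i j
    refine this.trans_eq ?_
    simp only [integral_const, probReal_univ, one_smul, ← Finset.sum_div]
    ring
  have h3 := integral_torusMeasure_sq_trace_steinMatrix_le hu hu2 hinj hadd
  gcongr

/-- The average over the sphere of the total variation distance of a random trigonometric sum to the
standard Gaussian, with a free parameter `t`. -/
theorem integral_sphereUniform_dTV_map_trigSum_le [Fintype ι] [Nonempty ι] {u : ι → Fin n → ℝ}
    (hu : ∀ i k, ∃ m : ℤ, u i k = m) (hu2 : ∀ i, u i ⬝ᵥ u i = 2) (hinj : Function.Injective u)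
    (hadd : ∀ i j, u i + u j ≠ 0) {t : ℝ} (ht : 0 < t) :
    ∫ θ, dTV (Measure.map (trigSum u fun i => √2 * (θ : EuclideanSpace ℝ ι) i) (torusMeasure n))
        (gaussianReal 0 1) ∂(sphereUniform ι) ≤
      4 * t * (((Fintype.card ι : ℝ) * (Fintype.card ι + 2))⁻¹ *
        ((Fintype.card ι : ℝ) / 4 + (∑ i, ∑ j, (u i ⬝ᵥ u j) ^ 2) / 2)) + t⁻¹ := by
  have hM := continuous_steinMatrix u
  have hint := (integrable_uncurry_sq_steinMatrix u).integral_prod_left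
  simp only [Function.uncurry_apply_pair] at hint
  have hbound := integral_sphereUniform_integral_torusMeasure_sq_le hu hu2 hinj hadd
  calc _ ≤ ∫ θ, (4 * t * ∫ x, (∑ i, ∑ j, (θ : EuclideanSpace ℝ ι) i *
        (θ : EuclideanSpace ℝ ι) j * steinMatrix u x i j) ^ 2 ∂(torusMeasure n)) + t⁻¹
        ∂(sphereUniform ι) := by
        refine integral_mono_of_nonneg (.of_forall fun _ => dTV_nonneg _ _)
          ((hint.const_mul _).add (integrable_const _)) (.of_forall fun θ => ?_)
        have hθ : ∑ i, (√2 * (θ : EuclideanSpace ℝ ι) i) ^ 2 = 2 := by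
          have := EuclideanSpace.real_norm_sq_eq (θ : EuclideanSpace ℝ ι)
          rw [norm_eq_of_mem_sphere θ] at this
          simp only [mul_pow, Real.sq_sqrt zero_le_two, ← Finset.mul_sum, ← this]
          norm_num
        refine (dTV_map_trigSum_le hu hu2 hθ).trans ?_
        have hq : ∀ x, 2 * |∑ i, ∑ j, √2 * (θ : EuclideanSpace ℝ ι) i *
            (√2 * (θ : EuclideanSpace ℝ ι) j) * steinMatrix u x i j| =
            4 * |∑ i, ∑ j, (θ : EuclideanSpace ℝ ι) i * (θ : EuclideanSpace ℝ ι) j *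
              steinMatrix u x i j| := by
          intro x
          have : ∀ i j, √2 * (θ : EuclideanSpace ℝ ι) i * (√2 * (θ : EuclideanSpace ℝ ι) j) *
              steinMatrix u x i j = 2 * ((θ : EuclideanSpace ℝ ι) i * (θ : EuclideanSpace ℝ ι) j *
              steinMatrix u x i j) := by
            intro i j
            linear_combination (θ : EuclideanSpace ℝ ι) i * (θ : EuclideanSpace ℝ ι) j *
              steinMatrix u x i j * Real.mul_self_sqrt zero_le_two
          simp only [this, ← Finset.mul_sum]
          rw [abs_mul, abs_two]
          ring
        have hcont : Continuous fun x => ∑ i, ∑ j, (θ : EuclideanSpace ℝ ι) i *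
            (θ : EuclideanSpace ℝ ι) j * steinMatrix u x i j := by fun_prop
        have hmono := integral_mono (μ := torusMeasure n)
          (f := fun x => 4 * |∑ i, ∑ j, (θ : EuclideanSpace ℝ ι) i *
            (θ : EuclideanSpace ℝ ι) j * steinMatrix u x i j|)
          (g := fun x => 4 * t * (∑ i, ∑ j, (θ : EuclideanSpace ℝ ι) i *
            (θ : EuclideanSpace ℝ ι) j * steinMatrix u x i j) ^ 2 + t⁻¹)
          (integrable_torusMeasure_of_continuous (by fun_prop))
          (integrable_torusMeasure_of_continuous (by fun_prop)) fun x => by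
            simp only
            generalize (∑ i, ∑ j, (θ : EuclideanSpace ℝ ι) i *
              (θ : EuclideanSpace ℝ ι) j * steinMatrix u x i j) = q
            have hsq : 4 * t * q ^ 2 + t⁻¹ - 4 * |q| = t⁻¹ * (2 * t * |q| - 1) ^ 2 := by
              rw [← sq_abs q]
              field_simp
              ring
            have : 0 ≤ t⁻¹ * (2 * t * |q| - 1) ^ 2 := by positivity
            linarith
        rw [← integral_const_mul]
        simp only [hq]
        refine hmono.trans_eq ?_
        rw [integral_add (integrable_torusMeasure_of_continuous (by fun_prop))
          (integrable_const _), integral_const_mul]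
        simp
    _ ≤ _ := by
        rw [integral_add (hint.const_mul _) (integrable_const _), integral_const_mul]
        simp only [integral_const, probReal_univ, one_smul]
        gcongr

end Torus

section Edges

variable {n : ℕ}

/-- The vector `e_i + e_j` attached to a pair `(i, j)`. -/
def pairVec (p : Fin n × Fin n) : Fin n → ℝ :=
  Pi.single p.1 1 + Pi.single p.2 1

theorem pairVec_apply (p : Fin n × Fin n) (k : Fin n) :
    pairVec p k = (if k = p.1 then 1 else 0) + (if k = p.2 then 1 else 0) := by
  simp [pairVec, Pi.single_apply]

theorem exists_int_eq_pairVec (p : Fin n × Fin n) (k : Fin n) : ∃ m : ℤ, pairVec p k = m :=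
  ⟨(if k = p.1 then 1 else 0) + (if k = p.2 then 1 else 0), by rw [pairVec_apply]; push_cast; rfl⟩

theorem pairVec_dotProduct (p : Fin n × Fin n) (w : Fin n → ℝ) :
    pairVec p ⬝ᵥ w = w p.1 + w p.2 := by
  simp [pairVec, add_dotProduct]

theorem pairVec_dotProduct_self {p : Fin n × Fin n} (hp : p.1 < p.2) :
    pairVec p ⬝ᵥ pairVec p = 2 := by
  rw [pairVec_dotProduct, pairVec_apply, pairVec_apply]
  simp [hp.ne, hp.ne']
  norm_num

theorem pairVec_add_pairVec_ne_zero (p q : Fin n × Fin n) : pairVec p + pairVec q ≠ 0 := by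
  intro h
  have h1 := congrFun h p.1
  simp only [Pi.add_apply, pairVec_apply, Pi.zero_apply, if_true] at h1
  split_ifs at h1 <;> norm_num at h1

theorem eq_of_pairVec_eq {p q : Fin n × Fin n} (hp : p.1 < p.2) (hq : q.1 < q.2)
    (h : pairVec p = pairVec q) : p = q := by
  have h1 := congrFun h p.1
  have h2 := congrFun h p.2
  simp only [pairVec_apply, if_true, hp.ne, hp.ne', if_false] at h1 h2
  have h3 : p.1 = q.1 ∨ p.1 = q.2 := by
    by_contra! hne
    norm_num [hne] at h1
  have h4 : p.2 = q.1 ∨ p.2 = q.2 := by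
    by_contra! hne
    norm_num [hne] at h2
  ext <;> omega

theorem sum_sq_pairVec_dotProduct_le (p : Fin n × Fin n) :
    ∑ q, (pairVec p ⬝ᵥ pairVec q) ^ 2 ≤ 16 * n := by
  have key : ∀ q : Fin n × Fin n, (pairVec p ⬝ᵥ pairVec q) ^ 2 ≤
      4 * (((if p.1 = q.1 then 1 else 0) + (if p.1 = q.2 then 1 else 0)) +
        ((if p.2 = q.1 then 1 else 0) + (if p.2 = q.2 then 1 else 0))) := by
    intro q
    rw [pairVec_dotProduct, pairVec_apply, pairVec_apply]
    split_ifs <;> norm_num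
  refine (Finset.sum_le_sum fun q _ => key q).trans_eq ?_
  rw [← Finset.mul_sum, Fintype.sum_prod_type]
  have hfst : ∀ a : Fin n, ∑ x : Fin n, ∑ _y : Fin n, (if a = x then (1 : ℝ) else 0) = n := by
    intro a
    rw [Finset.sum_comm]
    simp
  simp only [Finset.sum_add_distrib, hfst, Finset.sum_const, nsmul_eq_mul, Finset.sum_ite_eq,
    Finset.mem_univ, if_true, Finset.card_univ, Fintype.card_fin]
  ring

theorem sum_sum_sq_pairVec_dotProduct_le {ι : Type*} [Fintype ι] {p : ι → Fin n × Fin n}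
    (hp : Function.Injective p) :
    ∑ i, ∑ j, (pairVec (p i) ⬝ᵥ pairVec (p j)) ^ 2 ≤ 16 * n * Fintype.card ι := by
  have h : ∀ i, ∑ j, (pairVec (p i) ⬝ᵥ pairVec (p j)) ^ 2 ≤ 16 * n := by
    intro i
    refine le_trans ?_ (sum_sq_pairVec_dotProduct_le (p i))
    refine (Finset.sum_map Finset.univ ⟨p, hp⟩
      fun q => (pairVec (p i) ⬝ᵥ pairVec q) ^ 2).symm.trans_le ?_
    exact Finset.sum_le_sum_of_subset_of_nonneg (Finset.subset_univ _) fun _ _ _ => sq_nonneg _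
  refine (Finset.sum_le_sum fun i _ => h i).trans_eq ?_
  simp [mul_comm]

theorem sq_le_four_mul_card_filter_lt (hn : 2 ≤ n) :
    n ^ 2 ≤ 4 * (Finset.univ.filter fun p : Fin n × Fin n => p.1 < p.2).card := by
  have hswap : (Finset.univ.filter fun p : Fin n × Fin n => p.1 < p.2).card =
      (Finset.univ.filter fun p : Fin n × Fin n => p.2 < p.1).card :=
    Finset.card_equiv (Equiv.prodComm _ _) (by simp)
  have hcard : (Finset.univ : Finset (Fin n)).offDiag.card = n * n - n := by
    simp [Finset.offDiag_card]
  have hunion : (Finset.univ : Finset (Fin n)).offDiag =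
      (Finset.univ.filter fun p : Fin n × Fin n => p.1 < p.2) ∪
        Finset.univ.filter fun p : Fin n × Fin n => p.2 < p.1 := by
    ext p
    simp [lt_or_lt_iff_ne]
  have hle := Finset.card_union_le (Finset.univ.filter fun p : Fin n × Fin n => p.1 < p.2)
    (Finset.univ.filter fun p : Fin n × Fin n => p.2 < p.1)
  rw [← hunion, hcard, ← hswap] at hle
  have h2n : 2 * n ≤ n * n := Nat.mul_le_mul_right n hn
  have hsq : n ^ 2 = n * n := sq n
  omega

end Edges

theorem torusFun_eq_trigSum {n : ℕ} (B : Matrix (Fin n) (Fin n) ℝ) (𝒱 : Finset (Fin n → ℝ))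
    (a : ↥𝒱 → ℝ) : torusFun B 𝒱 a = trigSum (fun v : ↥𝒱 => B.mulVec v) a := by
  ext x
  rw [torusFun, trigSum, Complex.re_sum]
  refine Finset.sum_congr rfl fun v _ => ?_
  rw [Complex.re_ofReal_mul]
  congr 1
  have h : (2 * π * Complex.I * ((B.mulVec v ⬝ᵥ x : ℝ) : ℂ)) =
      ((2 * π * (B.mulVec v ⬝ᵥ x) : ℝ) : ℂ) * Complex.I := by
    push_cast
    ring
  rw [h, Complex.exp_ofReal_mul_I_re]

theorem stmt6 :
    ∃ C > (0 : ℝ), ∀ n : ℕ, 2 ≤ n → ∀ δ : Fin n → ℝ, (∀ i, -1 < δ i) →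
      ∀ B : Matrix (Fin n) (Fin n) ℝ, B = Matrix.diagonal (fun i => 1 + δ i) →
      ∀ ε : ℝ, IsGreatest (Set.range fun i : Fin n => |1 - 1 / (1 + δ i)|) ε → ε ≤ 1 →
      ∀ 𝒱' : Finset (Fin n → ℝ),
        𝒱' = ((Finset.univ.filter fun p : Fin n × Fin n => p.1 < p.2).image
              fun p => fun k =>
                (1 + δ k)⁻¹ * ((Pi.single p.1 (1 : ℝ) + Pi.single p.2 (1 : ℝ) : Fin n → ℝ) k)) →
        (∫ a, dTV (MeasureTheory.Measure.map (torusFun B 𝒱' a) (torusMeasure n))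
            (gaussianReal 0 1) ∂(coeffMeasure 𝒱'))
          ≤ C * max (1 / Real.sqrt n) ε := by
  refine ⟨145, by norm_num, ?_⟩
  intro n hn δ hδ B hB ε _ _ 𝒱' h𝒱
  have hδ0 : ∀ k, 1 + δ k ≠ 0 := fun k => by linarith [hδ k]
  have hBv : ∀ (v : Fin n → ℝ) k, B.mulVec v k = (1 + δ k) * v k := fun v k => by
    rw [hB, Matrix.mulVec_diagonal]
  have hex : ∀ v : ↥𝒱', ∃ p : Fin n × Fin n, p.1 < p.2 ∧ B.mulVec v = pairVec p := by
    rintro ⟨v, hv⟩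
    rw [h𝒱] at hv
    obtain ⟨p, hp, rfl⟩ := Finset.mem_image.1 hv
    refine ⟨p, (Finset.mem_filter.1 hp).2, ?_⟩
    ext k
    rw [hBv, mul_inv_cancel_left₀ (hδ0 k)]
    rfl
  choose p hp hu using hex
  have hinj : Function.Injective fun v : ↥𝒱' => B.mulVec v := by
    intro v w h
    ext k
    have := congrFun h k
    simp only [hBv] at this
    exact mul_left_cancel₀ (hδ0 k) this
  have hpinj : Function.Injective p := fun v w h => hinj (by simp only [hu, h])
  have hcard : n ^ 2 ≤ 4 * Fintype.card ↥𝒱' := by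
    rw [Fintype.card_coe, h𝒱, Finset.card_image_of_injOn]
    · exact sq_le_four_mul_card_filter_lt hn
    · intro q hq r hr h
      have hq' := (Finset.mem_filter.1 hq).2
      have hr' := (Finset.mem_filter.1 hr).2
      refine eq_of_pairVec_eq hq' hr' (funext fun k => ?_)
      exact mul_left_cancel₀ (inv_ne_zero (hδ0 k)) (congrFun h k)
  have hne : Nonempty ↥𝒱' := by
    refine Fintype.card_pos_iff.1 ?_
    have : 0 < n ^ 2 := by positivity
    omega
  have hn0 : (0 : ℝ) < n := by exact_mod_cast (by omega : 0 < n)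
  have hbound := integral_sphereUniform_dTV_map_trigSum_le
    (u := fun v : ↥𝒱' => B.mulVec v) (fun v k => by
      simp only [hu]
      exact exists_int_eq_pairVec _ _)
    (fun v => by simp only [hu, pairVec_dotProduct_self (hp v)]) hinj
    (fun v w => by simp only [hu]; exact pairVec_add_pairVec_ne_zero _ _)
    (Real.sqrt_pos.2 hn0)
  simp only [torusFun_eq_trigSum]
  have htransfer : ∫ a, dTV (MeasureTheory.Measure.map
      (trigSum (fun v : ↥𝒱' => B.mulVec v) a) (torusMeasure n)) (gaussianReal 0 1)
        ∂(coeffMeasure 𝒱') ≤ 145 * (1 / √n) := by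
    have hS : ∑ v : ↥𝒱', ∑ w : ↥𝒱', (B.mulVec v ⬝ᵥ B.mulVec w) ^ 2 ≤
        16 * n * Fintype.card ↥𝒱' := by
      simp only [hu]
      exact sum_sum_sq_pairVec_dotProduct_le hpinj
    have hcard' : (n : ℝ) ^ 2 ≤ 4 * Fintype.card ↥𝒱' := by exact_mod_cast hcard
    have hN : (0 : ℝ) < Fintype.card ↥𝒱' := by exact_mod_cast Fintype.card_pos
    have hn1 : (1 : ℝ) ≤ n := by exact_mod_cast (by omega : 1 ≤ n)
    have hnum : ((Fintype.card ↥𝒱' : ℝ) * (Fintype.card ↥𝒱' + 2))⁻¹ *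
        ((Fintype.card ↥𝒱' : ℝ) / 4 +
          (∑ v : ↥𝒱', ∑ w : ↥𝒱', (B.mulVec v ⬝ᵥ B.mulVec w) ^ 2) / 2) ≤ 36 / n := by
      rw [inv_mul_le_iff₀ (by positivity)]
      have h1 : (Fintype.card ↥𝒱' : ℝ) * 9 ≤ Fintype.card ↥𝒱' * (36 / n ^ 2 *
          (Fintype.card ↥𝒱')) := by
        gcongr
        rw [div_mul_eq_mul_div, le_div_iff₀ (by positivity)]
        linarith
      have h2 : (Fintype.card ↥𝒱' : ℝ) * (Fintype.card ↥𝒱' + 2) * (36 / n) ≥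
          n * (Fintype.card ↥𝒱' * (36 / n ^ 2 * (Fintype.card ↥𝒱'))) := by
        have : (n : ℝ) * (Fintype.card ↥𝒱' * (36 / n ^ 2 * (Fintype.card ↥𝒱'))) =
            (Fintype.card ↥𝒱' : ℝ) * (Fintype.card ↥𝒱' + 0) * (36 / n) := by
          field_simp
          ring
        rw [this]
        gcongr
        norm_num
      nlinarith [mul_le_mul_of_nonneg_left h1 hn0.le]
    by_cases hI : Integrable (fun a => dTV (MeasureTheory.Measure.map
        (trigSum (fun v : ↥𝒱' => B.mulVec v) a) (torusMeasure n)) (gaussianReal 0 1))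
        (coeffMeasure 𝒱')
    · rw [coeffMeasure] at hI ⊢
      rw [integral_map (by fun_prop) hI.aestronglyMeasurable]
      refine hbound.trans ?_
      have hs : √(n : ℝ) * √n = n := Real.mul_self_sqrt hn0.le
      have hs0 : 0 < √(n : ℝ) := Real.sqrt_pos.2 hn0
      calc _ ≤ 4 * √n * (36 / n) + (√(n : ℝ))⁻¹ := by gcongr
        _ = 145 * (1 / √n) := by
          have h36 : (36 : ℝ) / n = 36 / (√n * √n) := by rw [hs]
          rw [h36]
          field_simp
          norm_num
    · rw [integral_undef hI]
      positivity
  exact htransfer.trans (by gcongr; exact le_max_left _ _)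

end
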